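/- arXiv:2407.07765 — 2 statements merged into one kernel-verified Lean document; each statement's English description precedes it below -/
import Mathlib

section
/- The number τ(m) of types of m-subsets of vertices of a complete binary tree equals the number of branch-marked binary trees with m unmarked vertices; in particular τ(m) = Σ_{k=0}^{m-1} (m-k)·C(m+k-1, k)·2^k / m for all m ≥ 1. -/
/-- Lowest common ancestor of two vertices (bit strings) of the complete binary tree:
their longest common prefix. -/
def lca : List Bool → List Bool → List Bool
  | a :: as, b :: bs => if a = b then a :: lca as bs else []
  | _, _ => []

/-- A set of vertices is closed if it contains the LCA of any two of its members. -/
def IsLcaClosed (S : Set (List Bool)) : Prop :=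
  ∀ u ∈ S, ∀ v ∈ S, lca u v ∈ S

/-- The lcaClosure of `A`: the minimal closed set containing `A`. -/
def lcaClosure (A : Set (List Bool)) : Set (List Bool) :=
  ⋂₀ {S | IsLcaClosed S ∧ A ⊆ S}

/-- Two vertex sets are of the same type: a bijection between their closures mapping one set
onto the other which preserves the left- and right-descendant relations
(`v` is a left (right) descendant of `u` iff `u ++ [false] <+: v` (`u ++ [true] <+: v`)). -/
def SameType (A B : Set (List Bool)) : Prop :=
  ∃ φ : List Bool → List Bool,
    Set.BijOn φ (lcaClosure A) (lcaClosure B) ∧ φ '' A = B ∧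
    ∀ u ∈ lcaClosure A, ∀ v ∈ lcaClosure A,
      ((u ++ [false] <+: v) ↔ (φ u ++ [false] <+: φ v)) ∧
      ((u ++ [true] <+: v) ↔ (φ u ++ [true] <+: φ v))

/-- `tau m`: the number of types of `m`-subsets of vertices of the complete binary tree,
i.e. the number of equivalence classes of `m`-element vertex sets under `SameType`. -/
noncomputable def tau (m : ℕ) : ℕ :=
  Nat.card (Quot (fun A B : {A : Finset (List Bool) // A.card = m} =>
    SameType (A.1 : Set (List Bool)) (B.1 : Set (List Bool))))

/-- Branch-marked binary trees: every vertex has at most one left and at most one right child,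
and a vertex may be marked only if it has both children (a branching vertex). -/
inductive MBT where
  | leaf : MBT
  | nodeL (t : MBT) : MBT
  | nodeR (t : MBT) : MBT
  | node2 (marked : Bool) (l r : MBT) : MBT

/-- The number of unmarked vertices of a branch-marked binary tree. -/
def MBT.unmarked : MBT → ℕ
  | .leaf => 1
  | .nodeL t => 1 + t.unmarked
  | .nodeR t => 1 + t.unmarked
  | .node2 m l r => (if m then 0 else 1) + l.unmarked + r.unmarked

theorem lca_cons_same (b : Bool) (u v : List Bool) : lca (b :: u) (b :: v) = b :: lca u v := by
  simp [lca]

theorem lca_cons_ne {b c : Bool} (h : b ≠ c) (u v : List Bool) : lca (b :: u) (c :: v) = [] := by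
  simp [lca, h]

theorem lca_nil_left (v : List Bool) : lca [] v = [] := by
  simp [lca]

theorem lca_nil_right (v : List Bool) : lca v [] = [] := by
  cases v <;> simp [lca]

theorem subset_lcaClosure (A : Set (List Bool)) : A ⊆ lcaClosure A :=
  fun _ hx _ hS => hS.2 hx

theorem isLcaClosed_lcaClosure (A : Set (List Bool)) : IsLcaClosed (lcaClosure A) :=
  fun u hu v hv S hS => hS.1 u (hu S hS) v (hv S hS)

theorem lcaClosure_subset {A S : Set (List Bool)} (hS : IsLcaClosed S) (h : A ⊆ S) :
    lcaClosure A ⊆ S :=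
  fun _ hx => hx S ⟨hS, h⟩

/-- The part of `A` below the child `b` of the root, seen from that child. -/
def slice (A : Set (List Bool)) (b : Bool) : Set (List Bool) :=
  {w | b :: w ∈ A}

@[simp]
theorem mem_slice {A : Set (List Bool)} {b : Bool} {w : List Bool} :
    w ∈ slice A b ↔ b :: w ∈ A := Iff.rfl

theorem slice_lcaClosure (A : Set (List Bool)) (b : Bool) :
    slice (lcaClosure A) b = lcaClosure (slice A b) := by
  apply Set.Subset.antisymm
  · have hsub : lcaClosure A ⊆
        {u | ∀ c w, u = c :: w → w ∈ lcaClosure (slice A c)} := by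
      apply lcaClosure_subset
      · intro u hu v hv c w hw
        match u, v with
        | [], v => simp [lca_nil_left] at hw
        | u, [] => simp [lca_nil_right] at hw
        | a :: u, d :: v =>
          by_cases h : a = d
          · subst h
            rw [lca_cons_same, List.cons.injEq] at hw
            obtain ⟨rfl, rfl⟩ := hw
            exact isLcaClosed_lcaClosure _ _ (hu _ _ rfl) _ (hv _ _ rfl)
          · simp [lca_cons_ne h] at hw
      · rintro u hu c w rfl
        exact subset_lcaClosure _ hu
    exact fun w hw => hsub hw b w rfl
  · apply lcaClosure_subset
    · intro u hu v hv
      have := isLcaClosed_lcaClosure A _ hu _ hv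
      rwa [lca_cons_same] at this
    · exact fun w hw => subset_lcaClosure A hw

theorem nil_mem_lcaClosure {A : Set (List Bool)} :
    [] ∈ lcaClosure A ↔ [] ∈ A ∨ ∀ b, (slice A b).Nonempty := by
  constructor
  · intro h
    by_contra! hA
    obtain ⟨hnil, c, hc⟩ := hA
    have hsub : lcaClosure A ⊆ {u | ∃ w, u = (!c) :: w} := by
      apply lcaClosure_subset
      · rintro _ ⟨u, rfl⟩ _ ⟨v, rfl⟩
        exact ⟨_, lca_cons_same _ _ _⟩
      · intro u hu
        match u with
        | [] => exact absurd hu hnil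
        | d :: w =>
          by_cases h : d = c
          · subst h
            exact absurd (show w ∈ slice A d from hu) (by simp [hc])
          · exact ⟨w, by rw [Bool.eq_not.2 h]⟩
    obtain ⟨w, hw⟩ := hsub h
    simp at hw
  · rintro (h | h)
    · exact subset_lcaClosure A h
    · obtain ⟨u, hu⟩ := h false
      obtain ⟨v, hv⟩ := h true
      have := isLcaClosed_lcaClosure A _ (subset_lcaClosure A hu) _ (subset_lcaClosure A hv)
      rwa [lca_cons_ne (by simp)] at this

theorem lcaClosure_empty : lcaClosure ∅ = ∅ :=
  Set.subset_empty_iff.1 (lcaClosure_subset (fun _ h => h.elim) le_rfl)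

theorem sameType_iff {A B : Set (List Bool)} : SameType A B ↔
    ∃ φ : List Bool → List Bool,
      Set.BijOn φ (lcaClosure A) (lcaClosure B) ∧ φ '' A = B ∧
      ∀ u ∈ lcaClosure A, ∀ v ∈ lcaClosure A, ∀ c : Bool,
        u ++ [c] <+: v ↔ φ u ++ [c] <+: φ v := by
  simp [SameType, Bool.forall_bool]

theorem SameType.refl (A : Set (List Bool)) : SameType A A :=
  ⟨id, Set.bijOn_id _, by simp, by simp⟩

theorem SameType.symm {A B : Set (List Bool)} (h : SameType A B) : SameType B A := by
  rw [sameType_iff] at h ⊢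
  obtain ⟨φ, hb, hA, hd⟩ := h
  have hinv := hb.invOn_invFunOn
  have hb' := hb.symm hinv.symm
  refine ⟨_, hb', ?_, ?_⟩
  · rw [← hA]
    exact (hinv.1.mono (subset_lcaClosure A)).image_image
  · intro u hu v hv c
    rw [hd _ (hb'.mapsTo hu) _ (hb'.mapsTo hv), hinv.2 hu, hinv.2 hv]

theorem SameType.trans {A B C : Set (List Bool)} (h : SameType A B) (h' : SameType B C) :
    SameType A C := by
  rw [sameType_iff] at h h' ⊢
  obtain ⟨φ, hb, hA, hd⟩ := h
  obtain ⟨ψ, hb', hA', hd'⟩ := h'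
  refine ⟨ψ ∘ φ, hb'.comp hb, by rw [Set.image_comp, hA, hA'], ?_⟩
  intro u hu v hv c
  rw [hd _ hu _ hv, hd' _ (hb.mapsTo hu) _ (hb.mapsTo hv)]
  rfl

theorem SameType.ncard_eq {A B : Set (List Bool)} (h : SameType A B) : A.ncard = B.ncard := by
  obtain ⟨φ, hb, hA, -⟩ := h
  rw [← hA, (hb.injOn.mono (subset_lcaClosure A)).ncard_image]

theorem SameType.nonempty_iff {A B : Set (List Bool)} (h : SameType A B) :
    A.Nonempty ↔ B.Nonempty := by
  obtain ⟨φ, -, rfl, -⟩ := h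
  exact Set.image_nonempty.symm

theorem sameType_image_cons (b : Bool) (A : Set (List Bool)) :
    SameType A (List.cons b '' A) := by
  have hs : slice (List.cons b '' A) b = A := by
    ext w; simp
  rw [sameType_iff]
  refine ⟨List.cons b, ⟨?_, fun _ _ _ _ h => by simpa using h, ?_⟩, rfl, ?_⟩
  · intro w hw
    rwa [← mem_slice, slice_lcaClosure, hs]
  · intro u hu
    match u with
    | [] =>
      obtain h | h := nil_mem_lcaClosure.1 hu
      · simp at h
      · obtain ⟨w, hw⟩ := h (!b)
        simp at hw
    | c :: w =>
      rw [← mem_slice, slice_lcaClosure] at hu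
      by_cases h : b = c
      · subst h
        rw [hs] at hu
        exact ⟨w, hu, rfl⟩
      · have : slice (List.cons b '' A) c = ∅ := by
          ext w; simp [h]
        rw [this, lcaClosure_empty] at hu
        exact hu.elim
  · intro u _ v _ c
    simp

theorem sameType_of_slice {A B : Set (List Bool)} (hA : [] ∈ lcaClosure A)
    (hB : [] ∈ lcaClosure B) (hAB : [] ∈ A ↔ [] ∈ B)
    (h : ∀ b, SameType (slice A b) (slice B b)) : SameType A B := by
  simp only [sameType_iff, ← slice_lcaClosure] at h
  choose φ hb him hd using h
  rw [sameType_iff]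
  refine ⟨fun u => match u with | [] => [] | b :: w => b :: φ b w, ⟨?_, ?_, ?_⟩, ?_, ?_⟩
  · rintro (_ | ⟨b, w⟩) hu
    · exact hB
    · exact (hb b).mapsTo hu
  · rintro (_ | ⟨b, u⟩) hu (_ | ⟨c, v⟩) hv h
    · rfl
    · simp at h
    · simp at h
    · simp only [List.cons.injEq] at h
      obtain ⟨rfl, h⟩ := h
      rw [(hb b).injOn hu hv h]
  · rintro (_ | ⟨b, w⟩) hu
    · exact ⟨[], hA, rfl⟩
    · obtain ⟨v, hv, rfl⟩ := (hb b).surjOn hu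
      exact ⟨b :: v, hv, rfl⟩
  · ext u
    match u with
    | [] =>
      rw [← hAB]
      constructor
      · rintro ⟨_ | ⟨c, v⟩, hv, h⟩
        · exact hv
        · simp at h
      · exact fun h => ⟨[], h, rfl⟩
    | b :: w =>
      rw [← mem_slice (A := B), ← him b]
      constructor
      · rintro ⟨_ | ⟨c, v⟩, hv, h⟩
        · simp at h
        · simp only [List.cons.injEq] at h
          obtain ⟨rfl, rfl⟩ := h
          exact ⟨v, hv, rfl⟩
      · rintro ⟨v, hv, rfl⟩
        exact ⟨b :: v, hv, rfl⟩
  · rintro (_ | ⟨b, u⟩) hu (_ | ⟨c, v⟩) hv d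
    · simp
    · simp
    · simp
    · simp only [List.cons_append, List.cons_prefix_cons]
      refine and_congr_right ?_
      rintro rfl
      exact hd b u hu v hv d

/-- An isomorphism of types fixes the root and restricts to both subtrees of the root. -/
theorem SameType.slice {A B : Set (List Bool)} (hA : [] ∈ lcaClosure A)
    (hB : [] ∈ lcaClosure B) (h : SameType A B) :
    ([] ∈ A ↔ [] ∈ B) ∧ ∀ b, SameType (slice A b) (slice B b) := by
  rw [sameType_iff] at h
  obtain ⟨φ, hb, him, hd⟩ := h
  have h0 : φ [] = [] := by
    obtain ⟨_ | ⟨c, u⟩, hu, h⟩ := hb.surjOn hB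
    · exact h
    · have := (hd _ hA _ hu c).1 (by simp)
      simp [h] at this
  have hcons : ∀ b w, b :: w ∈ lcaClosure A → φ (b :: w) = b :: (φ (b :: w)).tail := by
    intro b w hw
    have := (hd _ hA _ hw b).1 (by simp)
    rw [h0] at this
    obtain ⟨t, ht⟩ := this
    rw [← ht]
    simp
  have hpre : ∀ u ∈ lcaClosure A, ∀ b w, φ u = b :: w →
      ∃ v, u = b :: v ∧ (φ (b :: v)).tail = w := by
    rintro (_ | ⟨c, v⟩) hu b w h
    · simp [h0] at h
    · have := hcons c v hu
      rw [h, List.cons.injEq] at this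
      obtain ⟨rfl, -⟩ := this
      exact ⟨v, rfl, by simp [h]⟩
  constructor
  · rw [← him]
    constructor
    · exact fun h => ⟨[], h, h0⟩
    · rintro ⟨u, hu, h⟩
      rwa [← hb.injOn (subset_lcaClosure A hu) hA (h.trans h0.symm)]
  · intro b
    rw [sameType_iff, ← slice_lcaClosure, ← slice_lcaClosure]
    refine ⟨fun w => (φ (b :: w)).tail, ⟨?_, ?_, ?_⟩, ?_, ?_⟩
    · intro w hw
      rw [mem_slice, ← hcons b w hw]
      exact hb.mapsTo hw
    · intro u hu v hv h
      have : φ (b :: u) = φ (b :: v) := by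
        rw [hcons b u hu, hcons b v hv]
        exact congrArg _ h
      simpa using hb.injOn hu hv this
    · intro w hw
      obtain ⟨u, hu, h⟩ := hb.surjOn hw
      obtain ⟨v, rfl, hv⟩ := hpre u hu b w h
      exact ⟨v, hu, hv⟩
    · ext w
      rw [mem_slice, ← him]
      constructor
      · rintro ⟨v, hv, rfl⟩
        exact ⟨b :: v, hv, hcons b v (subset_lcaClosure A hv)⟩
      · rintro ⟨u, hu, h⟩
        obtain ⟨v, rfl, hv⟩ := hpre u (subset_lcaClosure A hu) b w h
        exact ⟨v, hu, hv⟩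
    · intro u hu v hv c
      have := hd _ hu _ hv c
      rw [hcons b u hu, hcons b v hv] at this
      simpa using this

namespace MBT

/-- The unmarked vertices of a branch-marked tree, as vertices of the complete binary tree. -/
def points : MBT → Finset (List Bool)
  | .leaf => {[]}
  | .nodeL t => insert [] (t.points.image (List.cons false))
  | .nodeR t => insert [] (t.points.image (List.cons true))
  | .node2 m l r =>
    (if m then ∅ else {[]}) ∪ (l.points.image (List.cons false) ∪ r.points.image (List.cons true))

theorem card_points (t : MBT) : t.points.card = t.unmarked := by
  have hinj : ∀ b : Bool, Function.Injective (List.cons b) := fun b _ _ h => by simpa using h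
  induction t with
  | leaf => simp [points, unmarked]
  | nodeL t ih | nodeR t ih =>
    rw [points, Finset.card_insert_of_notMem (by simp), Finset.card_image_of_injective _ (hinj _),
      ih, unmarked, add_comm]
  | node2 m l r ihl ihr =>
    have hd : Disjoint (l.points.image (List.cons false)) (r.points.image (List.cons true)) := by
      simp [Finset.disjoint_left]
    have hd' : Disjoint (if m then ∅ else {[]} : Finset (List Bool))
        (l.points.image (List.cons false) ∪ r.points.image (List.cons true)) := by
      cases m <;> simp
    rw [points, Finset.card_union_of_disjoint hd', Finset.card_union_of_disjoint hd,
      Finset.card_image_of_injective _ (hinj _), Finset.card_image_of_injective _ (hinj _),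
      ihl, ihr, unmarked, add_assoc]
    cases m <;> simp

theorem unmarked_pos (t : MBT) : 0 < t.unmarked := by
  induction t <;> rw [unmarked] <;> omega

theorem points_nonempty (t : MBT) : (t.points : Set (List Bool)).Nonempty := by
  rw [Finset.coe_nonempty, ← Finset.card_pos, card_points]
  exact t.unmarked_pos

theorem slice_points_leaf (b : Bool) : slice (leaf.points : Set (List Bool)) b = ∅ := by
  ext; simp [points]

theorem slice_points_nodeL (t : MBT) (b : Bool) :
    slice ((nodeL t).points : Set (List Bool)) b = bif b then ∅ else t.points := by
  ext; cases b <;> simp [points]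

theorem slice_points_nodeR (t : MBT) (b : Bool) :
    slice ((nodeR t).points : Set (List Bool)) b = bif b then t.points else ∅ := by
  ext; cases b <;> simp [points]

theorem slice_points_node2 (m : Bool) (l r : MBT) (b : Bool) :
    slice ((node2 m l r).points : Set (List Bool)) b = bif b then r.points else l.points := by
  ext; cases b <;> cases m <;> simp [points]

theorem nil_mem_points_node2 (m : Bool) (l r : MBT) : [] ∈ (node2 m l r).points ↔ m = false := by
  cases m <;> simp [points]

theorem nil_mem_lcaClosure_points (t : MBT) : [] ∈ lcaClosure (t.points : Set (List Bool)) := by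
  rw [nil_mem_lcaClosure]
  cases t with
  | leaf | nodeL | nodeR => simp [points]
  | node2 m l r =>
    right
    rintro (_ | _) <;> simp [slice_points_node2, points_nonempty, -Finset.coe_nonempty]

theorem eq_of_sameType_points {t s : MBT} (h : SameType (t.points : Set (List Bool)) s.points) :
    t = s := by
  induction t generalizing s with
  | leaf =>
    obtain ⟨h0, h1⟩ := h.slice (nil_mem_lcaClosure_points _) (nil_mem_lcaClosure_points _)
    have hf := (h1 false).nonempty_iff
    have ht := (h1 true).nonempty_iff
    cases s <;> simp_all [slice_points_leaf, slice_points_nodeL, slice_points_nodeR,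
      slice_points_node2, points_nonempty, -Finset.coe_nonempty]
  | nodeL t ih =>
    obtain ⟨h0, h1⟩ := h.slice (nil_mem_lcaClosure_points _) (nil_mem_lcaClosure_points _)
    have hf := (h1 false).nonempty_iff
    have ht := (h1 true).nonempty_iff
    cases s with
    | nodeL s => exact congrArg nodeL (ih (by simpa [slice_points_nodeL] using h1 false))
    | _ => simp_all [slice_points_leaf, slice_points_nodeL, slice_points_nodeR,
        slice_points_node2, points_nonempty, -Finset.coe_nonempty]
  | nodeR t ih =>
    obtain ⟨h0, h1⟩ := h.slice (nil_mem_lcaClosure_points _) (nil_mem_lcaClosure_points _)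
    have hf := (h1 false).nonempty_iff
    have ht := (h1 true).nonempty_iff
    cases s with
    | nodeR s => exact congrArg nodeR (ih (by simpa [slice_points_nodeR] using h1 true))
    | _ => simp_all [slice_points_leaf, slice_points_nodeL, slice_points_nodeR,
        slice_points_node2, points_nonempty, -Finset.coe_nonempty]
  | node2 m l r ihl ihr =>
    obtain ⟨h0, h1⟩ := h.slice (nil_mem_lcaClosure_points _) (nil_mem_lcaClosure_points _)
    have hf := (h1 false).nonempty_iff
    have ht := (h1 true).nonempty_iff
    cases s with
    | node2 m' l' r' =>
      rw [Finset.mem_coe, Finset.mem_coe, nil_mem_points_node2, nil_mem_points_node2] at h0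
      have hm : m = m' := by cases m <;> cases m' <;> simp_all
      rw [hm, ihl (by simpa [slice_points_node2] using h1 false),
        ihr (by simpa [slice_points_node2] using h1 true)]
    | _ => simp_all [slice_points_leaf, slice_points_nodeL, slice_points_nodeR,
        slice_points_node2, points_nonempty, -Finset.coe_nonempty]

theorem exists_sameType_points (n : ℕ) (A : Set (List Bool)) (hA : A.Nonempty)
    (hn : ∀ u ∈ A, u.length < n) : ∃ t : MBT, SameType A t.points := by
  induction n generalizing A with
  | zero =>
    obtain ⟨u, hu⟩ := hA
    simpa using hn u hu
  | succ n ih =>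
    have hs : ∀ b, (slice A b).Nonempty → ∃ t : MBT, SameType (slice A b) t.points := by
      intro b hb
      refine ih _ hb fun u hu => ?_
      simpa using hn _ hu
    have hdesc : ∀ b, [] ∉ A → slice A (!b) = ∅ → ∃ t : MBT, SameType A t.points := by
      intro b hnil hb
      have himg : List.cons b '' slice A b = A := by
        ext u
        match u with
        | [] => simpa using hnil
        | c :: w =>
          by_cases hc : b = c
          · subst hc; simp
          · have : c = !b := by cases b <;> cases c <;> simp_all
            subst this
            have : w ∉ slice A (!b) := by simp [hb]
            simpa using this
      have hne : (slice A b).Nonempty := by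
        rw [← himg] at hA
        exact hA.of_image
      obtain ⟨t, ht⟩ := hs b hne
      refine ⟨t, ?_⟩
      rw [← himg]
      exact (sameType_image_cons b _).symm.trans ht
    have hbuild : ∀ t : MBT, [] ∈ lcaClosure A → ([] ∈ A ↔ [] ∈ t.points) →
        (∀ b, SameType (slice A b) (slice (t.points : Set (List Bool)) b)) →
        ∃ t : MBT, SameType A t.points := fun t h0 h1 h2 =>
      ⟨t, sameType_of_slice h0 (nil_mem_lcaClosure_points t) h1 h2⟩
    obtain hf | hf := (slice A false).eq_empty_or_nonempty <;>
      obtain ht | ht := (slice A true).eq_empty_or_nonempty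
    · by_cases hnil : [] ∈ A
      · refine hbuild leaf (subset_lcaClosure A hnil) (by simp [hnil, points]) ?_
        rintro (_ | _)
        · rw [hf, slice_points_leaf]; exact .refl _
        · rw [ht, slice_points_leaf]; exact .refl _
      · exact hdesc false hnil ht
    · by_cases hnil : [] ∈ A
      · obtain ⟨r, hr⟩ := hs true ht
        refine hbuild (nodeR r) (subset_lcaClosure A hnil) (by simp [hnil, points]) ?_
        rintro (_ | _)
        · simp [hf, slice_points_nodeR, SameType.refl]
        · rw [slice_points_nodeR]; exact hr
      · exact hdesc true hnil hf
    · by_cases hnil : [] ∈ A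
      · obtain ⟨l, hl⟩ := hs false hf
        refine hbuild (nodeL l) (subset_lcaClosure A hnil) (by simp [hnil, points]) ?_
        rintro (_ | _)
        · rw [slice_points_nodeL]; exact hl
        · simp [ht, slice_points_nodeL, SameType.refl]
      · exact hdesc false hnil ht
    · obtain ⟨l, hl⟩ := hs false hf
      obtain ⟨r, hr⟩ := hs true ht
      have h0 : [] ∈ lcaClosure A := nil_mem_lcaClosure.2 (.inr (by rintro (_ | _) <;> assumption))
      have hsl : ∀ m b, SameType (slice A b)
          (slice ((node2 m l r).points : Set (List Bool)) b) := by
        rintro m (_ | _)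
        · rw [slice_points_node2]; exact hl
        · rw [slice_points_node2]; exact hr
      by_cases hnil : [] ∈ A
      · exact hbuild (node2 false l r) h0 (by simp [hnil, points]) (hsl _)
      · exact hbuild (node2 true l r) h0 (by simp [hnil, points]) (hsl _)

end MBT

theorem tau_eq_card_mbt (m : ℕ) (hm : 1 ≤ m) : tau m = Nat.card {t : MBT // t.unmarked = m} := by
  let r := fun A B : {A : Finset (List Bool) // A.card = m} =>
    SameType (A.1 : Set (List Bool)) (B.1 : Set (List Bool))
  have hr : Equivalence r := ⟨fun _ => .refl _, .symm, .trans⟩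
  let f : {t : MBT // t.unmarked = m} → Quot r :=
    fun t => Quot.mk r ⟨t.1.points, t.1.card_points.trans t.2⟩
  have hf : Function.Bijective f := by
    constructor
    · intro t s h
      exact Subtype.ext (MBT.eq_of_sameType_points ((hr.quot_mk_eq_iff _ _).1 h))
    · rintro ⟨A, hA⟩
      have hne : (A : Set (List Bool)).Nonempty := by
        rw [Finset.coe_nonempty, ← Finset.card_pos]
        omega
      obtain ⟨t, ht⟩ := MBT.exists_sameType_points (A.sup List.length + 1) A hne
        fun u hu => Nat.lt_succ_of_le (Finset.le_sup (f := List.length) hu)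
      have hcard := ht.ncard_eq
      rw [Set.ncard_coe_finset, Set.ncard_coe_finset, hA, t.card_points] at hcard
      exact ⟨⟨t, hcard.symm⟩, (hr.quot_mk_eq_iff _ _).2 ht.symm⟩
  exact (Nat.card_congr (Equiv.ofBijective f hf)).symm

section GeneratingFunction

open PowerSeries

/-- The generating function counting the elements of a type by a weight. -/
noncomputable def weightGF {α : Type*} (w : α → ℕ) : ℤ⟦X⟧ :=
  PowerSeries.mk fun n => (Nat.card {a // w a = n} : ℤ)

theorem weightGF_congr {α β : Type*} (e : α ≃ β) {w : α → ℕ} {v : β → ℕ}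
    (h : ∀ a, w a = v (e a)) : weightGF w = weightGF v := by
  ext n
  simp only [weightGF, coeff_mk]
  rw [Nat.card_congr (e.subtypeEquiv (p := fun a => w a = n) (q := fun b => v b = n)
    fun a => by rw [h a])]

theorem weightGF_unit : weightGF (fun _ : Unit => 1) = X := by
  ext n
  simp only [weightGF, coeff_mk, coeff_X]
  by_cases h : n = 1
  · simp [h]
  · simp [h, Ne.symm h]

theorem weightGF_sum {α β : Type*} (w : α → ℕ) (v : β → ℕ)
    (hw : ∀ n, Finite {a // w a = n}) (hv : ∀ n, Finite {b // v b = n}) :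
    weightGF (Sum.elim w v) = weightGF w + weightGF v := by
  ext n
  simp only [weightGF, coeff_mk, map_add]
  have : Finite {a // Sum.elim w v (.inl a) = n} := hw n
  have : Finite {b // Sum.elim w v (.inr b) = n} := hv n
  rw [Nat.card_congr (Equiv.subtypeSum (p := fun x => Sum.elim w v x = n)), Nat.card_sum]
  simp

theorem weightGF_one_add {α : Type*} (w : α → ℕ) :
    weightGF (fun a => 1 + w a) = X * weightGF w := by
  ext n
  cases n with
  | zero => simp [weightGF]
  | succ n =>
    rw [coeff_succ_X_mul]
    simp only [weightGF, coeff_mk]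
    rw [Nat.card_congr (Equiv.subtypeEquivRight (p := fun a => 1 + w a = n + 1)
      (q := fun a => w a = n) fun a => by omega)]

/-- Pairs of total weight `n`, grouped by the weights of the components. -/
def weightProdEquiv {α β : Type*} (w : α → ℕ) (v : β → ℕ) (n : ℕ) :
    {p : α × β // w p.1 + v p.2 = n} ≃
      Σ q : Finset.HasAntidiagonal.antidiagonal n, {a // w a = q.1.1} × {b // v b = q.1.2} where
  toFun p := ⟨⟨(w p.1.1, v p.1.2), by simpa using p.2⟩, ⟨p.1.1, rfl⟩, ⟨p.1.2, rfl⟩⟩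
  invFun s := ⟨(s.2.1.1, s.2.2.1), by
    rw [s.2.1.2, s.2.2.2]; exact Finset.HasAntidiagonal.mem_antidiagonal.1 s.1.2⟩
  left_inv _ := rfl
  right_inv := by
    rintro ⟨⟨⟨i, j⟩, h⟩, ⟨a, ha⟩, ⟨b, hb⟩⟩
    change w a = i at ha
    change v b = j at hb
    subst ha hb
    rfl

theorem weightGF_prod {α β : Type*} (w : α → ℕ) (v : β → ℕ)
    (hw : ∀ n, Finite {a // w a = n}) (hv : ∀ n, Finite {b // v b = n}) :
    weightGF (fun p : α × β => w p.1 + v p.2) = weightGF w * weightGF v := by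
  ext n
  rw [coeff_mul]
  simp only [weightGF, coeff_mk]
  rw [Nat.card_congr (weightProdEquiv w v n), Nat.card_sigma]
  simp only [Nat.card_prod]
  rw [Finset.sum_coe_sort (Finset.HasAntidiagonal.antidiagonal n) fun q =>
    Nat.card {a // w a = q.1} * Nat.card {b // v b = q.2}]
  push_cast
  rfl

namespace MBT

/-- Decomposition of a branch-marked tree at its root. -/
def equivSum : MBT ≃ Unit ⊕ MBT ⊕ MBT ⊕ (MBT × MBT) ⊕ (MBT × MBT) where
  toFun
    | .leaf => .inl ()
    | .nodeL t => .inr (.inl t)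
    | .nodeR t => .inr (.inr (.inl t))
    | .node2 false l r => .inr (.inr (.inr (.inl (l, r))))
    | .node2 true l r => .inr (.inr (.inr (.inr (l, r))))
  invFun
    | .inl _ => .leaf
    | .inr (.inl t) => .nodeL t
    | .inr (.inr (.inl t)) => .nodeR t
    | .inr (.inr (.inr (.inl (l, r)))) => .node2 false l r
    | .inr (.inr (.inr (.inr (l, r)))) => .node2 true l r
  left_inv t := by
    match t with
    | .leaf | .nodeL _ | .nodeR _ | .node2 false _ _ | .node2 true _ _ => rfl
  right_inv x := by
    rcases x with _ | _ | _ | _ | _ <;> rfl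

theorem finite_unmarked_lt (n : ℕ) : {t : MBT | t.unmarked < n}.Finite := by
  induction n with
  | zero => simp
  | succ n ih =>
    set S := {t : MBT | t.unmarked < n}
    refine Set.Finite.subset ((Set.finite_singleton leaf).union ((ih.image nodeL).union
      ((ih.image nodeR).union (((Set.finite_univ (α := Bool)).prod (ih.prod ih)).image
        fun p => node2 p.1 p.2.1 p.2.2)))) ?_
    intro t ht
    rw [Set.mem_ofPred_eq] at ht
    cases t with
    | leaf => simp
    | nodeL t =>
      rw [unmarked] at ht
      exact .inr (.inl ⟨t, show t.unmarked < n by omega, rfl⟩)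
    | nodeR t =>
      rw [unmarked] at ht
      exact .inr (.inr (.inl ⟨t, show t.unmarked < n by omega, rfl⟩))
    | node2 m l r =>
      rw [unmarked] at ht
      have hl := l.unmarked_pos
      have hr := r.unmarked_pos
      exact .inr (.inr (.inr ⟨(m, l, r), ⟨trivial, show l.unmarked < n by omega,
        show r.unmarked < n by omega⟩, rfl⟩))

theorem finite_unmarked_eq (n : ℕ) : Finite {t : MBT // t.unmarked = n} :=
  ((finite_unmarked_lt (n + 1)).subset fun t (ht : t.unmarked = n) => by simp [ht]).to_subtype

theorem weightGF_unmarked : weightGF unmarked =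
    X + (X * weightGF unmarked + (X * weightGF unmarked +
      (X * (weightGF unmarked * weightGF unmarked) + weightGF unmarked * weightGF unmarked))) := by
  have h1 := finite_unmarked_eq
  have h2 : ∀ n, Finite {p : MBT × MBT // p.1.unmarked + p.2.unmarked = n} := fun n =>
    Finite.of_equiv _ (weightProdEquiv unmarked unmarked n).symm
  have hsucc : ∀ {α : Type} (w : α → ℕ), (∀ n, Finite {a // w a = n}) →
      ∀ n, Finite {a // 1 + w a = n} := fun w h n =>
    Finite.of_injective (fun a : {a // 1 + w a = n} => (⟨a.1, by have := a.2; omega⟩ :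
      {a // w a = n - 1})) fun a b hab => by simpa [Subtype.ext_iff] using hab
  have hsum : ∀ {α β : Type} (w : α → ℕ) (v : β → ℕ), (∀ n, Finite {a // w a = n}) →
      (∀ n, Finite {b // v b = n}) → ∀ n, Finite {x // Sum.elim w v x = n} :=
    fun w v hw hv n =>
      have : Finite {a // Sum.elim w v (.inl a) = n} := hw n
      have : Finite {b // Sum.elim w v (.inr b) = n} := hv n
      Finite.of_equiv _ (Equiv.subtypeSum (p := fun x => Sum.elim w v x = n)).symm
  have key := weightGF_congr equivSum (w := unmarked)
    (v := Sum.elim (fun _ => 1) (Sum.elim (fun t => 1 + t.unmarked) (Sum.elim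
      (fun t => 1 + t.unmarked) (Sum.elim (fun p => 1 + (p.1.unmarked + p.2.unmarked))
        (fun p => p.1.unmarked + p.2.unmarked))))) (by
    intro t
    match t with
    | .leaf | .nodeL _ | .nodeR _ => rfl
    | .node2 false _ _ | .node2 true _ _ => simp [equivSum, unmarked, add_assoc])
  have f4 := hsum _ _ (hsucc _ h2) h2
  have f3 := hsum _ _ (hsucc _ h1) f4
  have f2 := hsum _ _ (hsucc _ h1) f3
  rwa [weightGF_sum _ _ (fun n => inferInstance) f2, weightGF_sum _ _ (hsucc _ h1) f3,
    weightGF_sum _ _ (hsucc _ h1) f4, weightGF_sum _ _ (hsucc _ h2) h2, weightGF_unit,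
    weightGF_one_add, weightGF_one_add (fun p : MBT × MBT => p.1.unmarked + p.2.unmarked),
    weightGF_prod _ _ h1 h1] at key

theorem constantCoeff_weightGF_unmarked : constantCoeff (weightGF unmarked) = 0 := by
  rw [← coeff_zero_eq_constantCoeff_apply, weightGF, coeff_mk]
  have : IsEmpty {t : MBT // t.unmarked = 0} := ⟨fun t => t.1.unmarked_pos.ne' t.2⟩
  simp

end MBT

theorem coeff_succ_pow_of_eq_one_add {C : ℤ⟦X⟧} (hC : C = 1 + 2 * X * C ^ 2) (n j : ℕ) :
    coeff (n + 1) (C ^ (j + 1)) = coeff (n + 1) (C ^ j) + 2 * coeff n (C ^ (j + 2)) := by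
  have h : C ^ (j + 1) = C ^ j + X * ((2 : ℤ) • C ^ (j + 2)) := by
    rw [zsmul_eq_mul]
    push_cast
    linear_combination C ^ j * hC
  conv_lhs => rw [h]
  rw [map_add, coeff_succ_X_mul, map_smul, smul_eq_mul]

theorem coeff_pow_of_eq_one_add {C : ℤ⟦X⟧} (hC : C = 1 + 2 * X * C ^ 2) (n j : ℕ) :
    coeff (n + 1) (C ^ j) = 2 ^ (n + 1) *
      (((2 * n + 1 + j).choose (n + 1) : ℤ) - (2 * n + 1 + j).choose n) := by
  induction n generalizing j with
  | zero =>
    have h0 : constantCoeff C = 1 := by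
      rw [hC]; simp
    induction j with
    | zero => simp [coeff_one]
    | succ j ih =>
      rw [coeff_succ_pow_of_eq_one_add hC, ih, coeff_zero_eq_constantCoeff_apply, map_pow, h0]
      simp
      ring
  | succ n ih =>
    induction j with
    | zero =>
      have : (2 * (n + 1) + 1).choose (n + 1 + 1) = (2 * (n + 1) + 1).choose (n + 1) :=
        Nat.choose_symm_half (n + 1)
      simp [coeff_one, this]
    | succ j ihj =>
      rw [coeff_succ_pow_of_eq_one_add hC, ihj, ih]
      rw [show 2 * (n + 1) + 1 + (j + 1) = (2 * (n + 1) + 1 + j) + 1 by ring,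
        show 2 * n + 1 + (j + 2) = 2 * (n + 1) + 1 + j by ring,
        Nat.choose_succ_succ _ (n + 1), Nat.choose_succ_succ _ n]
      push_cast
      ring

theorem add_mul_coeff_pow_of_eq_one_add {C : ℤ⟦X⟧} (hC : C = 1 + 2 * X * C ^ 2) (k j : ℕ) :
    ((k + j : ℕ) : ℤ) * coeff k (C ^ j) = j * (2 * k + j - 1).choose k * 2 ^ k := by
  cases k with
  | zero =>
    have h0 : constantCoeff C = 1 := by
      rw [hC]; simp
    simp [h0]
  | succ n =>
    rw [coeff_pow_of_eq_one_add hC, show 2 * (n + 1) + j - 1 = 2 * n + 1 + j by omega]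
    have h := Nat.choose_succ_right_eq (2 * n + 1 + j) n
    rw [show 2 * n + 1 + j - n = n + 1 + j by omega] at h
    zify at h
    push_cast
    linear_combination 2 ^ (n + 1) * h

theorem coeff_eq_sum_of_eq_one_add {C G : ℤ⟦X⟧} (hG : G = 1 + X * C * G) (m : ℕ) :
    coeff m G = ∑ k ∈ Finset.range (m + 1), coeff k (C ^ (m - k)) := by
  have h : ∀ N : ℕ, G = ∑ j ∈ Finset.range N, (X * C) ^ j + X ^ N * (C ^ N * G) := by
    intro N
    induction N with
    | zero => simp
    | succ N ih =>
      rw [Finset.sum_range_succ]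
      linear_combination ih + X ^ N * C ^ N * hG
  rw [h (m + 1), map_add, coeff_X_pow_mul', if_neg (by omega), add_zero, map_sum,
    ← Finset.sum_range_reflect]
  refine Finset.sum_congr rfl fun k hk => ?_
  have hk' : k ≤ m := by simpa [Nat.lt_succ_iff] using hk
  rw [mul_pow, coeff_X_pow_mul', if_pos (by omega)]
  congr 2
  omega

theorem MBT.mul_card_unmarked_eq (m : ℕ) (hm : 1 ≤ m) :
    m * Nat.card {t : MBT // t.unmarked = m} =
      ∑ k ∈ Finset.range m, (m - k) * Nat.choose (m + k - 1) k * 2 ^ k := by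
  set T := weightGF MBT.unmarked with hTdef
  have hT := MBT.weightGF_unmarked
  have hT0 := MBT.constantCoeff_weightGF_unmarked
  rw [← hTdef] at hT hT0
  have hunit : IsUnit (1 + T) := by
    rw [PowerSeries.isUnit_iff_constantCoeff]
    simp [hT0]
  obtain ⟨H, hH⟩ := hunit.exists_right_inv
  have hu0 : constantCoeff (T * H) = 0 := by simp [hT0]
  obtain ⟨C, hC⟩ := X_dvd_iff.2 hu0
  have hCeq : C = 1 + 2 * X * C ^ 2 := by
    refine mul_left_cancel₀ (X_ne_zero (R := ℤ)) ?_
    have h1 : T * H = X + 2 * (T * H) ^ 2 := by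
      linear_combination H ^ 2 * hT + (-T * H + X * (H * (1 + T) + 1)) * hH
    rw [hC] at h1
    linear_combination h1
  have hG : 1 + T = 1 + X * C * (1 + T) := by
    rw [← hC]
    linear_combination (-T) * hH
  have hcoeff : (Nat.card {t : MBT // t.unmarked = m} : ℤ) =
      ∑ k ∈ Finset.range (m + 1), coeff k (C ^ (m - k)) := by
    rw [← coeff_eq_sum_of_eq_one_add hG, map_add, coeff_one, if_neg (by omega), zero_add, hTdef,
      weightGF, coeff_mk]
  rw [← Nat.cast_inj (R := ℤ)]
  push_cast
  rw [hcoeff, Finset.mul_sum, Finset.sum_range_succ, Nat.sub_self, pow_zero, coeff_one,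
    if_neg (by omega), mul_zero, add_zero]
  refine Finset.sum_congr rfl fun k hk => ?_
  have hk' : k < m := Finset.mem_range.1 hk
  have h := add_mul_coeff_pow_of_eq_one_add hCeq k (m - k)
  rw [show k + (m - k) = m by omega, show 2 * k + (m - k) - 1 = m + k - 1 by omega] at h
  exact h

end GeneratingFunction

/-- The number `τ(m)` of types of `m`-subsets equals the number of branch-marked binary trees
with `m` unmarked vertices, and (multiplying out the division by `m`)
`τ(m) = Σ_{k=0}^{m-1} (m-k)·C(m+k-1,k)·2^k / m`. -/
theorem tau_eq_generalized_catalan (m : ℕ) (hm : 1 ≤ m) :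
    tau m = Nat.card {t : MBT // t.unmarked = m} ∧
    m * tau m = ∑ k ∈ Finset.range m, (m - k) * Nat.choose (m + k - 1) k * 2 ^ k := by
  have h := tau_eq_card_mbt m hm
  exact ⟨h, h ▸ MBT.mul_card_unmarked_eq m hm⟩
end

section
/- For all integers m ≥ 2, d ≥ m, k ≥ 2, the Ramsey number for m-chains satisfies R(d,m,k) ≤ twr_m(5 · 2^(m-2) · d · k^(2^(m-1)) · log₂ k), where twr_1(x) = x and twr_{i+1}(x) = 2^(twr_i(x)). That is, if n is at least this tower bound, then for every coloring with k colors of all m-chains of a complete binary tree of depth n there exists a complete subtree of depth d that is type-monochromatic. -/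
/-- Vertices of the complete binary tree are bit strings (`List Bool`).
`SubtreeMap n d f` : `f` embeds the complete binary tree of depth `d` as a subtree
(preserving left/right descendant relations) of the complete binary tree of depth `n`. -/
def SubtreeMap (n d : ℕ) (f : List Bool → List Bool) : Prop :=
  (∀ s : List Bool, s.length ≤ d → (f s).length ≤ n) ∧
  (∀ s : List Bool, ∀ b : Bool, s.length < d → f s ++ [b] <+: f (s ++ [b]))

/-- Two `m`-chains have the same type: corresponding pairs have the same left/right
descendant relations (equivalently, the same tuples of left/right turns). -/
def SameTurns (m : ℕ) (C D : Fin m → List Bool) : Prop :=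
  ∀ i j : Fin m, i < j → ∀ b : Bool, ((C i ++ [b] <+: C j) ↔ (D i ++ [b] <+: D j))

/-- `C` is an `m`-chain (vertices strictly increasing in the descendant/prefix order) all of
whose vertices lie in the subtree given by `f` (of depth `d`). -/
def ChainIn (m d : ℕ) (f : List Bool → List Bool) (C : Fin m → List Bool) : Prop :=
  (∀ i j : Fin m, i < j → C i <+: C j ∧ C i ≠ C j) ∧
  (∀ i : Fin m, ∃ s : List Bool, s.length ≤ d ∧ C i = f s)

/-- `HasRamsey n d m k`: for every coloring with `k` colors of the `m`-chains of the complete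
binary tree of depth `n`, there is a complete subtree of depth `d` that is type-monochromatic
(any two `m`-chains of the same type in the subtree have the same color). -/
def HasRamsey (n d m k : ℕ) : Prop :=
  ∀ χ : (Fin m → List Bool) → Fin k,
    ∃ f : List Bool → List Bool, SubtreeMap n d f ∧
      ∀ C D : Fin m → List Bool, ChainIn m d f C → ChainIn m d f D →
        SameTurns m C D → χ C = χ D

/-- The tower function, 0-indexed: `twr 0 x = x`, `twr (i+1) x = 2 ^ twr i x`.
(The paper's `twr_t` is `twr (t-1)` here.) -/
noncomputable def twr : ℕ → ℝ → ℝ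
  | 0, x => x
  | n + 1, x => 2 ^ twr n x

namespace BinaryTree

theorem exists_turn_of_prefix_of_ne {s t : List Bool} (h : s <+: t) (hne : s ≠ t) :
    ∃ b, s ++ [b] <+: t := by
  obtain ⟨u, rfl⟩ := h
  cases u with
  | nil => simp at hne
  | cons b u => exact ⟨b, u, by simp⟩

theorem isPrefix_of_append {s t u : List Bool} (h : s ++ u <+: t) : s <+: t :=
  (List.prefix_append s u).trans h

theorem ne_of_turn {s t : List Bool} {b : Bool} (h : s ++ [b] <+: t) : s ≠ t := by
  rintro rfl
  simpa using h.length_le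

theorem turn_unique {s t : List Bool} {a b : Bool} (ha : s ++ [a] <+: t) (hb : s ++ [b] <+: t) :
    a = b := by
  have h := (List.prefix_of_prefix_length_le ha hb (by simp)).eq_of_length (by simp)
  simpa using h

theorem relative_position (s t : List Bool) :
    s = t ∨ (∃ b, s ++ [b] <+: t) ∨ (∃ b, t ++ [b] <+: s) ∨
      ∃ u b, u ++ [b] <+: s ∧ u ++ [!b] <+: t := by
  induction s generalizing t with
  | nil =>
    cases t with
    | nil => exact Or.inl rfl
    | cons b t => exact Or.inr (Or.inl ⟨b, by simp⟩)
  | cons a s ih =>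
    cases t with
    | nil => exact Or.inr (Or.inr (Or.inl ⟨a, by simp⟩))
    | cons b t =>
      by_cases hab : a = b
      · subst hab
        rcases ih t with h | ⟨c, h⟩ | ⟨c, h⟩ | ⟨u, c, h, h'⟩
        · exact Or.inl (by rw [h])
        · exact Or.inr (Or.inl ⟨c, by simpa using h⟩)
        · exact Or.inr (Or.inr (Or.inl ⟨c, by simpa using h⟩))
        · exact Or.inr (Or.inr (Or.inr ⟨a :: u, c, by simpa using h, by simpa using h'⟩))
      · have hb : b = !a := by cases a <;> cases b <;> simp_all
        exact Or.inr (Or.inr (Or.inr ⟨[], a, by simp, by simp [hb]⟩))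

theorem _root_.SubtreeMap.map_turn {n d : ℕ} {f : List Bool → List Bool}
    (hf : SubtreeMap n d f) {s t : List Bool} {b : Bool} (h : s ++ [b] <+: t)
    (ht : t.length ≤ d) : f s ++ [b] <+: f t := by
  obtain ⟨u, rfl⟩ := h
  induction u using List.reverseRecOn with
  | nil => simpa using hf.2 s b (by simp at ht; omega)
  | append_singleton u a ih =>
    have ht' : (s ++ [b] ++ u).length < d := by simp at ht ⊢; omega
    rw [← List.append_assoc]
    exact (ih ht'.le).trans (isPrefix_of_append (hf.2 _ a ht'))

theorem _root_.SubtreeMap.turn_iff {n d : ℕ} {f : List Bool → List Bool}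
    (hf : SubtreeMap n d f) {s t : List Bool} {b : Bool} (hs : s.length ≤ d)
    (ht : t.length ≤ d) : f s ++ [b] <+: f t ↔ s ++ [b] <+: t := by
  refine ⟨fun h => ?_, fun h => hf.map_turn h ht⟩
  rcases relative_position s t with rfl | ⟨a, h'⟩ | ⟨a, h'⟩ | ⟨u, a, h₁, h₂⟩
  · exact absurd rfl (ne_of_turn h)
  · rwa [turn_unique h (hf.map_turn h' ht)]
  · have h₁ := h.length_le
    have h₂ := (hf.map_turn h' hs).length_le
    simp at h₁ h₂
    omega
  · have h₃ := (hf.map_turn h₁ hs).trans (isPrefix_of_append h)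
    have := turn_unique h₃ (hf.map_turn h₂ ht)
    simp at this

theorem _root_.SubtreeMap.comp {n N d : ℕ} {f g : List Bool → List Bool}
    (hf : SubtreeMap n N f) (hg : SubtreeMap N d g) : SubtreeMap n d (f ∘ g) :=
  ⟨fun s hs => hf.1 _ (hg.1 s hs),
    fun s b hs => hf.map_turn (hg.2 s b hs) (hg.1 _ (by simpa using hs))⟩

/-- The map sending the root to itself and each child subtree by the corresponding map. -/
def glue (g : Bool → List Bool → List Bool) : List Bool → List Bool
  | [] => []
  | b :: s => b :: g b s

theorem subtreeMap_glue {n d : ℕ} {g : Bool → List Bool → List Bool}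
    (hg : ∀ b, SubtreeMap n d (g b)) : SubtreeMap (n + 1) (d + 1) (glue g) := by
  constructor
  · rintro (_ | ⟨b, s⟩) hs
    · simp [glue]
    · simpa [glue] using (hg b).1 s (by simpa using hs)
  · rintro (_ | ⟨a, s⟩) b hs
    · simp [glue]
    · simpa [glue] using (hg a).2 s b (by simpa using hs)

theorem subtreeMap_cons {n d : ℕ} {g : List Bool → List Bool} (hg : SubtreeMap n d g) (b : Bool) :
    SubtreeMap (n + 1) d (fun s => b :: g s) :=
  ⟨fun s hs => by simpa using hg.1 s hs, fun s a hs => by simpa using hg.2 s a hs⟩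

/-- Asymmetric pigeonhole principle for vertex colorings of binary trees. -/
theorem exists_monochromatic_of_sum_le {α : Type*} [Fintype α] (n : ℕ) (c : List Bool → α)
    (d : α → ℕ) (h : ∑ a, d a ≤ n) :
    ∃ a f, SubtreeMap n (d a) f ∧ ∀ s, s.length ≤ d a → c (f s) = a := by
  classical
  induction n generalizing c d with
  | zero =>
    have hd : d (c []) = 0 := by
      have := Finset.single_le_sum (f := d) (fun _ _ => Nat.zero_le _) (Finset.mem_univ (c []))
      omega
    exact ⟨c [], fun _ => [], ⟨by simp, by simp [hd]⟩, by simp⟩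
  | succ n ih =>
    rcases hd : d (c []) with _ | e
    · exact ⟨c [], fun _ => [], ⟨by simp, by simp [hd]⟩, by simp⟩
    · have hsum : ∑ a, Function.update d (c []) e a ≤ n := by
        have h₁ := Finset.sum_update_of_mem (Finset.mem_univ (c [])) d e
        have h₂ := Finset.sum_eq_add_sum_sdiff_singleton_of_mem (Finset.mem_univ (c [])) d
        omega
      choose a g hg hc using fun b : Bool => ih (fun s => c (b :: s)) _ hsum
      by_cases hab : ∃ b, a b ≠ c []
      · obtain ⟨b, hb⟩ := hab
        have hg := hg b
        have hc := hc b
        rw [Function.update_of_ne hb] at hg hc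
        exact ⟨a b, _, subtreeMap_cons hg b, hc⟩
      · push Not at hab
        simp only [hab, Function.update_self] at hg hc
        refine ⟨c [], glue g, hd ▸ subtreeMap_glue hg, ?_⟩
        rintro (_ | ⟨b, s⟩) hs
        · rfl
        · exact hc b s (by simp at hs; omega)

theorem exists_monochromatic {α : Type*} [Fintype α] {n d : ℕ} (c : List Bool → α)
    (h : Fintype.card α * d ≤ n) :
    ∃ f, SubtreeMap n d f ∧ ∀ s t, s.length ≤ d → t.length ≤ d → c (f s) = c (f t) := by
  obtain ⟨a, f, hf, hc⟩ := exists_monochromatic_of_sum_le n c (fun _ => d) (by simpa using h)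
  exact ⟨f, hf, fun s t hs ht => (hc s hs).trans (hc t ht).symm⟩

/-- A depth sufficient for the existence of an end-homogeneous subtree, when a vertex is colored
relative to `i` marked ancestors with `K i` colors. -/
def endDepth : ℕ → (ℕ → ℕ) → ℕ
  | 0, _ => 0
  | N + 1, K => K 1 * endDepth N (fun i => K (i + 1)) + 1

/-- If vertices are colored relative to lists of ancestors, there is a subtree in which the color
of a vertex relative to the full list of ancestors of `s` depends only on its side of `s`. -/
theorem exists_endHomogeneous (N n : ℕ) (K : ℕ → ℕ) (β : List (List Bool) → Type)
    [∀ L, Fintype (β L)] (hβ : ∀ L, Fintype.card (β L) ≤ K L.length)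
    (col : (L : List (List Bool)) → List Bool → β L) (hn : endDepth N K ≤ n) :
    ∃ f, SubtreeMap n N f ∧ ∀ s b t t', s ++ [b] <+: t → s ++ [b] <+: t' →
      t.length ≤ N → t'.length ≤ N →
      col (s.inits.map f) (f t) = col (s.inits.map f) (f t') := by
  induction N generalizing n K β with
  | zero =>
    refine ⟨fun _ => [], ⟨by simp, by simp⟩, fun _ _ _ _ _ _ _ _ => rfl⟩
  | succ N ih =>
    obtain _ | n := n
    · simp [endDepth] at hn
    have hn' : K 1 * endDepth N (fun i => K (i + 1)) ≤ n := by simpa [endDepth] using hn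
    choose h hh hc using fun b : Bool => exists_monochromatic (n := n)
      (d := endDepth N (fun i => K (i + 1))) (fun s => col [[]] (b :: s))
      ((Nat.mul_le_mul_right _ (hβ [[]])).trans hn')
    choose g hg hgc using fun b : Bool => ih (endDepth N (fun i => K (i + 1)))
      (fun i => K (i + 1)) (fun L => β ([] :: L.map fun s => b :: h b s))
      (fun L => by simpa using hβ ([] :: L.map fun s => b :: h b s))
      (fun L v => col ([] :: L.map fun s => b :: h b s) (b :: h b v)) le_rfl
    refine ⟨glue fun b => h b ∘ g b, subtreeMap_glue fun b => (hh b).comp (hg b), ?_⟩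
    rintro (_ | ⟨a, s⟩) b t t' ht ht' hl hl'
    · obtain ⟨u, rfl⟩ := ht
      obtain ⟨u', rfl⟩ := ht'
      exact hc b _ _ ((hg b).1 u (by simp at hl; omega)) ((hg b).1 u' (by simp at hl'; omega))
    · obtain ⟨u, rfl⟩ := ht
      obtain ⟨u', rfl⟩ := ht'
      have key := hgc a s b (s ++ [b] ++ u) (s ++ [b] ++ u') (by simp) (by simp)
        (by simp at hl ⊢; omega) (by simp at hl' ⊢; omega)
      have hL : (a :: s).inits.map (glue fun b => h b ∘ g b) =
          [] :: (s.inits.map (g a)).map fun s => a :: h a s := by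
        simp [glue, Function.comp_def]
      rw [hL]
      exact key

theorem endDepth_lt {k : ℕ} (hk : 2 ≤ k) (p N j : ℕ) :
    endDepth N (fun i => k ^ (i + j) ^ p) + 1 ≤ k ^ (N * (N + j) ^ p) := by
  induction N generalizing j with
  | zero => simp [endDepth]
  | succ N ih =>
    have h₁ := ih (j + 1)
    have hK : (fun i => k ^ (i + 1 + j) ^ p) = fun i => k ^ (i + (j + 1)) ^ p := by
      funext i
      rw [show i + 1 + j = i + (j + 1) by ring]
    have hpos : 2 ≤ k ^ (1 + j) ^ p := by
      calc 2 ≤ k := hk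
        _ = k ^ 1 := (pow_one k).symm
        _ ≤ k ^ (1 + j) ^ p := Nat.pow_le_pow_right (by omega) (Nat.one_le_pow _ _ (by omega))
    have hexp : (1 + j) ^ p + N * (N + (j + 1)) ^ p ≤ (N + 1) * (N + 1 + j) ^ p := by
      have : (1 + j) ^ p ≤ (N + 1 + j) ^ p := Nat.pow_le_pow_left (by omega) p
      rw [show N + (j + 1) = N + 1 + j by ring]
      linarith
    simp only [endDepth, hK]
    calc k ^ (1 + j) ^ p * endDepth N (fun i => k ^ (i + (j + 1)) ^ p) + 1 + 1
        ≤ k ^ (1 + j) ^ p * (endDepth N (fun i => k ^ (i + (j + 1)) ^ p) + 1) := by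
          rw [mul_add]; omega
      _ ≤ k ^ (1 + j) ^ p * k ^ (N * (N + (j + 1)) ^ p) := Nat.mul_le_mul_left _ h₁
      _ = k ^ ((1 + j) ^ p + N * (N + (j + 1)) ^ p) := (pow_add _ _ _).symm
      _ ≤ _ := Nat.pow_le_pow_right (by omega) hexp

/-- Strictly increasing tuples in the prefix order. -/
def StrictChain {m : ℕ} (S : Fin m → List Bool) : Prop :=
  ∀ i j, i < j → S i <+: S j ∧ S i ≠ S j

theorem StrictChain.isPrefix {m : ℕ} {S : Fin m → List Bool} (hS : StrictChain S) {i j : Fin m}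
    (h : i ≤ j) : S i <+: S j := by
  rcases h.eq_or_lt with rfl | h
  · exact List.prefix_rfl
  · exact (hS i j h).1

/-- Passing to a subtree, the color of a `(p + 2)`-chain depends only on its first `p + 1` vertices
and on its last turn. -/
theorem exists_subtree_color_eq_of_last_turn {α : Type} [Fintype α] {p N n : ℕ}
    (hα : 2 ≤ Fintype.card α) (c : (Fin (p + 2) → List Bool) → α)
    (hn : Fintype.card α ^ N ^ (p + 1) ≤ n) :
    ∃ f, SubtreeMap n N f ∧ ∀ (S : Fin (p + 1) → List Bool) (b : Bool) (t : List Bool),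
      StrictChain S → S (Fin.last p) ++ [b] <+: t → t.length ≤ N →
      c (f ∘ Fin.snoc (α := fun _ => List Bool) S t) =
        c (f ∘ Fin.snoc (α := fun _ => List Bool) S (S (Fin.last p) ++ [b])) := by
  obtain ⟨f, hf, hc⟩ := exists_endHomogeneous N n (fun i => Fintype.card α ^ i ^ p)
    (fun L => (Fin p → Fin L.length) → α) (fun L => by simp)
    (fun L v idx => c (Fin.snoc (α := fun _ => List Bool)
      (Fin.snoc (α := fun _ => List Bool) (fun i => L.get (idx i)) (L.getLastD [])) v))
    (by
      have := endDepth_lt hα p N 0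
      simp only [add_zero, ← pow_succ'] at this
      omega)
  refine ⟨f, hf, fun S b t hS hb ht => ?_⟩
  have hmem : ∀ i : Fin p, ∃ j, ((S (Fin.last p)).inits.map f).get j = f (S i.castSucc) := by
    intro i
    refine List.mem_iff_get.1 (List.mem_map_of_mem ?_)
    exact (List.mem_inits _ _).2 (hS.isPrefix (Fin.le_last _))
  choose idx hidx using hmem
  have hlast : ((S (Fin.last p)).inits.map f).getLastD [] = f (S (Fin.last p)) := by
    have h : ∀ s : List Bool, s.inits.getLast? = some s := by
      intro s
      induction s with
      | nil => rfl
      | cons a s ih => simp [List.getLast?_cons, List.getLast?_map, ih]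
    rw [List.getLastD_eq_getLast?, List.getLast?_map, h]
    rfl
  have hsnoc : ∀ v, (f ∘ Fin.snoc (α := fun _ => List Bool) S v : Fin (p + 2) → List Bool) =
      Fin.snoc (α := fun _ => List Bool) (Fin.snoc (α := fun _ => List Bool)
        (fun i => ((S (Fin.last p)).inits.map f).get (idx i))
        (((S (Fin.last p)).inits.map f).getLastD [])) (f v) := by
    intro v
    funext i
    refine Fin.lastCases ?_ (fun i => ?_) i
    · simp
    · refine Fin.lastCases ?_ (fun i => ?_) i
      · simp only [Function.comp_apply, Fin.snoc_castSucc, Fin.snoc_last, hlast]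
      · simp only [Function.comp_apply, Fin.snoc_castSucc, hidx]
  rw [hsnoc, hsnoc]
  exact congrFun (hc _ b t _ hb List.prefix_rfl ht (hb.length_le.trans ht)) idx

/-- A depth sufficient for the Ramsey property of `(p + 1)`-chains with `k` colors. -/
def chainDepth (d : ℕ) : ℕ → ℕ → ℕ
  | 0, k => k * d
  | p + 1, k => k ^ chainDepth d p (k ^ 2) ^ (p + 1)

theorem exists_typeMonochromatic (d p n : ℕ) {α : Type} [Fintype α] (hα : 2 ≤ Fintype.card α)
    (c : (Fin (p + 1) → List Bool) → α) (hn : chainDepth d p (Fintype.card α) ≤ n) :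
    ∃ f, SubtreeMap n d f ∧ ∀ S T : Fin (p + 1) → List Bool, StrictChain S → StrictChain T →
      (∀ i, (S i).length ≤ d) → (∀ i, (T i).length ≤ d) → SameTurns (p + 1) S T →
      c (f ∘ S) = c (f ∘ T) := by
  induction p generalizing n α with
  | zero =>
    obtain ⟨f, hf, hc⟩ := exists_monochromatic (fun s => c fun _ => s) hn
    refine ⟨f, hf, fun S T _ _ hS hT _ => ?_⟩
    have h : ∀ S : Fin (0 + 1) → List Bool, f ∘ S = fun _ => f (S 0) := by
      intro S
      funext i
      rw [show i = 0 from Subsingleton.elim (α := Fin 1) i 0]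
      rfl
    rw [h S, h T]
    exact hc _ _ (hS 0) (hT 0)
  | succ p ih =>
    obtain ⟨f, hf, hc⟩ := exists_subtree_color_eq_of_last_turn hα c hn
    have hcard : Fintype.card (Bool → α) = Fintype.card α ^ 2 := by simp
    obtain ⟨g, hg, hgc⟩ := ih (chainDepth d p (Fintype.card α ^ 2)) (α := Bool → α)
      (by rw [hcard]; nlinarith)
      (fun S b => c (f ∘ Fin.snoc (α := fun _ => List Bool) S (S (Fin.last p) ++ [b])))
      (by rw [hcard])
    refine ⟨f ∘ g, hf.comp hg, fun S T hS hT hSd hTd hST => ?_⟩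
    have hlt : (Fin.last p).castSucc < Fin.last (p + 1) := Fin.castSucc_lt_last _
    obtain ⟨b, hb⟩ := exists_turn_of_prefix_of_ne (hS _ _ hlt).1 (hS _ _ hlt).2
    have hb' := (hST _ _ hlt b).1 hb
    have hinit : ∀ U : Fin (p + 2) → List Bool, StrictChain U → (∀ i, (U i).length ≤ d) →
        U (Fin.last p).castSucc ++ [b] <+: U (Fin.last (p + 1)) →
        c ((f ∘ g) ∘ U) = c (f ∘ Fin.snoc (α := fun _ => List Bool)
          (g ∘ (Fin.init U : Fin (p + 1) → List Bool))
          ((g ∘ (Fin.init U : Fin (p + 1) → List Bool)) (Fin.last p) ++ [b])) := by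
      intro U hU hUd hUb
      rw [← hc (g ∘ (Fin.init U : Fin (p + 1) → List Bool)) b (g (U (Fin.last (p + 1)))) ?_
        (hg.map_turn hUb (hUd _)) (hg.1 _ (hUd _))]
      · congr 1
        funext i
        refine Fin.lastCases ?_ (fun i => ?_) i
        · simp
        · simp [Fin.init]
      · intro i j hij
        have hij' : i.castSucc < j.castSucc := hij
        obtain ⟨a, ha⟩ := exists_turn_of_prefix_of_ne (hU _ _ hij').1 (hU _ _ hij').2
        have := hg.map_turn ha (hUd _)
        exact ⟨isPrefix_of_append this, ne_of_turn this⟩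
    rw [hinit S hS hSd hb, hinit T hT hTd hb']
    exact congrFun (hgc (Fin.init S) (Fin.init T) (fun i j hij => hS _ _ hij)
      (fun i j hij => hT _ _ hij) (fun i => hSd _) (fun i => hTd _)
      (fun i j hij a => hST i.castSucc j.castSucc hij a)) b

theorem hasRamsey_of_chainDepth_le {d p k n : ℕ} (hk : 2 ≤ k) (hn : chainDepth d p k ≤ n) :
    HasRamsey n d (p + 1) k := by
  intro χ
  obtain ⟨f, hf, hc⟩ := exists_typeMonochromatic d p n (by simpa using hk) χ (by simpa using hn)
  refine ⟨f, hf, ?_⟩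
  rintro C D ⟨hC, hC'⟩ ⟨hD, hD'⟩ hCD
  choose S hSd hS using hC'
  choose T hTd hT using hD'
  obtain rfl : C = f ∘ S := funext hS
  obtain rfl : D = f ∘ T := funext hT
  have hchain : ∀ U : Fin (p + 1) → List Bool, (∀ i, (U i).length ≤ d) →
      StrictChain (f ∘ U) → StrictChain U := by
    intro U hU hfU i j hij
    obtain ⟨b, hb⟩ := exists_turn_of_prefix_of_ne (hfU i j hij).1 (hfU i j hij).2
    have := (hf.turn_iff (hU i) (hU j)).1 hb
    exact ⟨isPrefix_of_append this, ne_of_turn this⟩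
  refine hc S T (hchain S hSd hC) (hchain T hTd hD) hSd hTd fun i j hij b => ?_
  rw [← hf.turn_iff (hSd i) (hSd j), ← hf.turn_iff (hTd i) (hTd j)]
  exact hCD i j hij b

theorem one_le_chainDepth {d p k : ℕ} (hd : 1 ≤ d) (hk : 1 ≤ k) : 1 ≤ chainDepth d p k := by
  cases p with
  | zero => exact Nat.mul_pos hk hd
  | succ p => exact Nat.one_le_pow _ _ hk

theorem logb_two_le_self {k : ℕ} (hk : 1 ≤ k) : Real.logb 2 k ≤ k := by
  rw [Real.logb_le_iff_le_rpow (by norm_num) (by exact_mod_cast hk), Real.rpow_natCast]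
  exact_mod_cast Nat.lt_two_pow_self.le

theorem two_rpow_mul_logb {k : ℕ} (hk : 1 ≤ k) (x : ℕ) :
    (2 : ℝ) ^ (x * Real.logb 2 k) = (k : ℝ) ^ x := by
  rw [mul_comm, Real.rpow_mul (by norm_num),
    Real.rpow_logb (by norm_num) (by norm_num) (by exact_mod_cast hk), Real.rpow_natCast]

theorem chainDepth_le_twr {d : ℕ} (hd : 1 ≤ d) (r : ℕ) {k : ℕ} (hk : 2 ≤ k) :
    (r + 4) * Real.logb 2 k * (chainDepth d (r + 1) k : ℝ) ^ (r + 2) ≤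
      twr (r + 1) (5 * 2 ^ r * d * (k : ℝ) ^ (2 ^ (r + 1)) * Real.logb 2 k) := by
  induction r generalizing k with
  | zero =>
    have h₁ : (4 : ℝ) * k ≤ (k : ℝ) ^ 3 := by
      have : 4 * k ≤ k ^ 3 := by nlinarith [Nat.mul_le_mul hk hk]
      exact_mod_cast this
    have h₂ : (k : ℝ) ^ 3 ≤ (k : ℝ) ^ (3 * (d * k ^ 2)) := by
      refine pow_le_pow_right₀ (by exact_mod_cast (by omega : 1 ≤ k)) ?_
      have : 1 ≤ d * k ^ 2 := Nat.mul_pos hd (by positivity)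
      omega
    have hx : (5 : ℝ) * 2 ^ 0 * d * (k : ℝ) ^ (2 ^ (0 + 1)) * Real.logb 2 k =
        ((5 * (d * k ^ 2) : ℕ) : ℝ) * Real.logb 2 k := by
      push_cast
      ring
    simp only [twr]
    rw [hx, two_rpow_mul_logb (by omega)]
    have hc : (chainDepth d (0 + 1) k : ℝ) ^ (0 + 2) = (k : ℝ) ^ (2 * (d * k ^ 2)) := by
      simp only [chainDepth]
      push_cast
      rw [← pow_mul]
      congr 1
      ring
    rw [hc]
    calc ((0 : ℕ) + 4 : ℝ) * Real.logb 2 k * (k : ℝ) ^ (2 * (d * k ^ 2))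
        ≤ (k : ℝ) ^ (3 * (d * k ^ 2)) * (k : ℝ) ^ (2 * (d * k ^ 2)) := by
          have := logb_two_le_self (show 1 ≤ k by omega)
          gcongr
          norm_num
          linarith
      _ = (k : ℝ) ^ (5 * (d * k ^ 2)) := by
          rw [← pow_add]
          congr 1
          ring
  | succ r ih =>
    have hih := ih (k := k ^ 2) (by nlinarith)
    set Y := chainDepth d (r + 1) (k ^ 2) ^ (r + 2) with hY
    have hY1 : 1 ≤ Y := Nat.one_le_pow _ _ (one_le_chainDepth hd (Nat.one_le_pow _ _ (by omega)))
    have hlog : Real.logb 2 ((k ^ 2 : ℕ) : ℝ) = 2 * Real.logb 2 k := by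
      rw [Nat.cast_pow, Real.logb_pow]
      norm_num
    have hx : (5 : ℝ) * 2 ^ r * d * (((k ^ 2 : ℕ) : ℝ)) ^ (2 ^ (r + 1)) *
        Real.logb 2 ((k ^ 2 : ℕ) : ℝ) =
        5 * 2 ^ (r + 1) * d * (k : ℝ) ^ (2 ^ (r + 1 + 1)) * Real.logb 2 k := by
      rw [hlog, Nat.cast_pow, ← pow_mul, ← pow_succ']
      ring
    rw [hx, hlog] at hih
    have hih' : (((2 * r + 8) * Y : ℕ) : ℝ) * Real.logb 2 k ≤
        twr (r + 1) (5 * 2 ^ (r + 1) * d * (k : ℝ) ^ (2 ^ (r + 1 + 1)) * Real.logb 2 k) := by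
      refine le_trans (le_of_eq ?_) hih
      rw [hY]
      push_cast
      ring
    have hpow : (k : ℝ) ^ ((2 * r + 8) * Y) ≤
        twr (r + 2) (5 * 2 ^ (r + 1) * d * (k : ℝ) ^ (2 ^ (r + 1 + 1)) * Real.logb 2 k) := by
      rw [← two_rpow_mul_logb (by omega)]
      exact Real.rpow_le_rpow_of_exponent_le (by norm_num) hih'
    refine le_trans ?_ hpow
    have hc : (chainDepth d (r + 1 + 1) k : ℝ) ^ (r + 1 + 2) = (k : ℝ) ^ ((r + 3) * Y) := by
      have : chainDepth d (r + 1 + 1) k = k ^ Y := rfl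
      rw [this]
      push_cast
      rw [← pow_mul, mul_comm]
    have hsmall : ((r + 5 : ℕ) : ℝ) * k ≤ (k : ℝ) ^ ((r + 5) * Y) := by
      have h₁ : r + 5 ≤ k ^ (r + 4) := by
        calc r + 5 ≤ 2 ^ (r + 4) := Nat.lt_two_pow_self
          _ ≤ k ^ (r + 4) := Nat.pow_le_pow_left hk _
      have h₂ : k ^ (r + 5) ≤ k ^ ((r + 5) * Y) :=
        Nat.pow_le_pow_right (by omega) (Nat.le_mul_of_pos_right _ hY1)
      have h₃ : (r + 5) * k ≤ k ^ ((r + 5) * Y) := by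
        refine le_trans ?_ h₂
        rw [pow_succ]
        exact Nat.mul_le_mul_right _ h₁
      exact_mod_cast h₃
    rw [hc]
    calc (((r + 1 : ℕ) : ℝ) + 4) * Real.logb 2 k * (k : ℝ) ^ ((r + 3) * Y)
        ≤ (k : ℝ) ^ ((r + 5) * Y) * (k : ℝ) ^ ((r + 3) * Y) := by
          have h := logb_two_le_self (show 1 ≤ k by omega)
          gcongr
          refine le_trans ?_ hsmall
          push_cast
          rw [show ((r : ℝ) + 1 + 4) = r + 5 by ring]
          gcongr
      _ = (k : ℝ) ^ ((2 * r + 8) * Y) := by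
          rw [← pow_add]
          congr 1
          ring

end BinaryTree

/-- Ramsey theorem for `m`-chains with tower-type bound: for `m ≥ 2`, `d ≥ m`, `k ≥ 2`, if
`n ≥ twr_m(5·2^(m-2)·d·k^(2^(m-1))·log₂ k)` then every `k`-coloring of the `m`-chains of the
complete binary tree of depth `n` admits a type-monochromatic complete subtree of depth `d`. -/
theorem ramsey_chains_tower_bound (d m k n : ℕ) (hm : 2 ≤ m) (hd : m ≤ d) (hk : 2 ≤ k)
    (hn : (n : ℝ) ≥
      twr (m - 1) (5 * 2 ^ (m - 2) * d * (k : ℝ) ^ (2 ^ (m - 1)) * Real.logb 2 k)) :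
    HasRamsey n d m k := by
  obtain ⟨r, rfl⟩ := Nat.exists_eq_add_of_le' hm
  refine BinaryTree.hasRamsey_of_chainDepth_le (p := r + 1) hk ?_
  have hle := BinaryTree.chainDepth_le_twr (show 1 ≤ d by omega) r hk
  have hone : (1 : ℝ) ≤ BinaryTree.chainDepth d (r + 1) k := by
    exact_mod_cast BinaryTree.one_le_chainDepth (by omega) (by omega)
  have hlog : 1 ≤ Real.logb 2 k := by
    rw [Real.le_logb_iff_rpow_le (by norm_num) (by positivity)]
    simpa using hk
  have hcoef : (1 : ℝ) ≤ (r + 4) * Real.logb 2 k := by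
    nlinarith [(Nat.cast_nonneg r : (0 : ℝ) ≤ r)]
  have hself : (BinaryTree.chainDepth d (r + 1) k : ℝ) ≤
      (r + 4) * Real.logb 2 k * (BinaryTree.chainDepth d (r + 1) k : ℝ) ^ (r + 2) := by
    have := le_self_pow₀ hone (show r + 2 ≠ 0 by omega)
    exact this.trans (le_mul_of_one_le_left (by positivity) hcoef)
  exact_mod_cast (hself.trans hle).trans hn
end
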